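/- arXiv:2005.03262 — 2 statements merged into one kernel-verified Lean document; each statement's English description precedes it below -/
import Mathlib

section
/- If the set Ran_m(k) is a convex subset of [0,∞)^E, then Ψ_m(q̄) = Ψ⁺_m(q̄) for every q̄ ∈ M(E) with div q̄ = 0; in particular there are no dynamical phase transitions. -/
open MeasureTheory Filter Set
open scoped Classical ENNReal NNReal

/-- The Boltzmann entropy function `s(a|b)`, with values in `[0,∞]`. -/
noncomputable def entS (a b : ℝ) : ℝ≥0∞ :=
  if 0 < a ∧ 0 < b then ENNReal.ofReal (a * Real.log (a / b) - a + b)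
  else if a = 0 ∧ 0 ≤ b then ENNReal.ofReal b
  else ⊤

/-- Real-valued entropy function `s(a|b) = a log(a/b) - a + b` (used when `a,b > 0`). -/
noncomputable def sR (a b : ℝ) : ℝ := a * Real.log (a / b) - a + b

/-- `M_m(X)`: nonnegative measures on `X` of total mass `m`. -/
def Mmass {X : Type*} [Fintype X] (m : ℝ) : Set (X → ℝ) :=
  {ρ | (∀ x, 0 ≤ ρ x) ∧ ∑ x, ρ x = m}

/-- `M(E)`: nonnegative flows on the edge set `E`. -/
def MFlow {X : Type*} (E : Finset (X × X)) : Set ((X × X) → ℝ) :=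
  {w | ∀ e ∈ E, 0 ≤ w e}

/-- Discrete divergence of a flow. -/
def divFlow {X : Type*} [DecidableEq X] (E : Finset (X × X)) (w : (X × X) → ℝ) (x : X) : ℝ :=
  ∑ e ∈ E, ((if e.1 = x then w e else 0) - (if e.2 = x then w e else 0))

/-- Admissible pair on `[0,T]`: `ρ ∈ W^{1,1}(0,T;M_m(X))`, `q ∈ L¹(0,T;M(E))`,
with the continuity equation `ρ̇ + div q = 0`. -/
def IsAdmissible {X : Type*} [Fintype X] [DecidableEq X] (E : Finset (X × X)) (m T : ℝ)
    (ρ : ℝ → X → ℝ) (q : ℝ → (X × X) → ℝ) : Prop :=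
  (∀ t ∈ Icc (0:ℝ) T, ρ t ∈ Mmass m) ∧
  (∀ t ∈ Icc (0:ℝ) T, q t ∈ MFlow E) ∧
  (∀ e ∈ E, IntervalIntegrable (fun t => q t e) volume 0 T) ∧
  (∀ x, ∀ t ∈ Icc (0:ℝ) T, ρ t x = ρ 0 x - ∫ s in (0:ℝ)..t, divFlow E (q s) x)

/-- The set `A_{T,m}(q̄)`: admissible pairs whose time-averaged flow is `q̄`. -/
def InAdm {X : Type*} [Fintype X] [DecidableEq X] (E : Finset (X × X)) (m T : ℝ)
    (qbar : (X × X) → ℝ) (ρ : ℝ → X → ℝ) (q : ℝ → (X × X) → ℝ) : Prop :=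
  IsAdmissible E m T ρ q ∧ ∀ e ∈ E, (∫ t in (0:ℝ)..T, q t e) = T * qbar e

/-- The cost `I_{[0,T]}(ρ,q)`. -/
noncomputable def costI {X : Type*} [Fintype X] [DecidableEq X] (E : Finset (X × X))
    (k : (X → ℝ) → (X × X) → ℝ) (T : ℝ) (ρ : ℝ → X → ℝ) (q : ℝ → (X × X) → ℝ) : ℝ≥0∞ :=
  ∑ e ∈ E, ∫⁻ t in Ioc (0:ℝ) T, entS (q t e) (k (ρ t) e)

/-- `Ψ_{T,m}(q̄)`, with the convention `inf ∅ = ⊤`. -/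
noncomputable def PsiT {X : Type*} [Fintype X] [DecidableEq X] (E : Finset (X × X))
    (k : (X → ℝ) → (X × X) → ℝ) (m T : ℝ) (qbar : (X × X) → ℝ) : ℝ≥0∞ :=
  ENNReal.ofReal (1 / T) *
    ⨅ (p : (ℝ → X → ℝ) × (ℝ → (X × X) → ℝ)) (_ : InAdm E m T qbar p.1 p.2),
      costI E k T p.1 p.2

/-- `Ψ_{T,m}(q̄ | ρ*)`: same, restricted to pairs with `ρ(0) = ρ*`. -/
noncomputable def PsiTInit {X : Type*} [Fintype X] [DecidableEq X] (E : Finset (X × X))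
    (k : (X → ℝ) → (X × X) → ℝ) (m T : ℝ) (qbar : (X × X) → ℝ) (ρstar : X → ℝ) : ℝ≥0∞ :=
  ENNReal.ofReal (1 / T) *
    ⨅ (p : (ℝ → X → ℝ) × (ℝ → (X × X) → ℝ))
      (_ : InAdm E m T qbar p.1 p.2 ∧ p.1 0 = ρstar),
      costI E k T p.1 p.2

/-- `Ψ_m(q̄) := lim_{T→∞} Ψ_{T,m}(q̄)`, realised as a `limsup`, which coincides with the
limit whenever the limit exists. -/
noncomputable def PsiM {X : Type*} [Fintype X] [DecidableEq X] (E : Finset (X × X))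
    (k : (X → ℝ) → (X × X) → ℝ) (m : ℝ) (qbar : (X × X) → ℝ) : ℝ≥0∞ :=
  Filter.limsup (fun T => PsiT E k m T qbar) Filter.atTop

/-- `Ψ⁺_m(q̄)`: the cost of the optimal constant strategy (only for divergence-free `q̄`). -/
noncomputable def PsiPlus {X : Type*} [Fintype X] [DecidableEq X] (E : Finset (X × X))
    (k : (X → ℝ) → (X × X) → ℝ) (m : ℝ) (qbar : (X × X) → ℝ) : ℝ≥0∞ :=
  if ∀ x, divFlow E qbar x = 0 then
    ⨅ (ρ : X → ℝ) (_ : ρ ∈ Mmass m), ∑ e ∈ E, entS (qbar e) (k ρ e)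
  else ⊤

/-- The standing assumptions on the jump rates `k`. -/
def RateAssumptions {X : Type*} [Fintype X] (E : Finset (X × X)) (m : ℝ)
    (k : (X → ℝ) → (X × X) → ℝ) : Prop :=
  (∀ ρ ∈ Mmass (X := X) m, ∀ e ∈ E, 0 ≤ k ρ e) ∧
  (∃ C : ℝ≥0, ∀ e ∈ E, LipschitzOnWith C (fun ρ => k ρ e) (Mmass m)) ∧
  (∀ e ∈ E, ∀ ρ σ : X → ℝ, ρ ∈ Mmass m → σ ∈ Mmass m → ρ ≤ σ → k ρ e ≤ k σ e) ∧
  (∀ e ∈ E, ∀ ε > 0, ∃ δ > 0, ∀ ρ ∈ Mmass (X := X) m, ρ e.1 < δ → k ρ e < ε) ∧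
  (∃ φ : ℝ → ℝ, MonotoneOn φ (Icc 0 1) ∧ Set.BijOn φ (Icc 0 1) (Icc 0 1) ∧
    ∀ ρ ∈ Mmass (X := X) m, ∀ δ ∈ Icc (0:ℝ) 1, ∀ e ∈ E, φ δ * k ρ e ≤ k (δ • ρ) e)

/-- A lower bound for the entropy function by the linear functions of which it is the supremum. -/
lemma ofReal_linear_le_entS (θ a b : ℝ) :
    ENNReal.ofReal (θ * a - b * (Real.exp θ - 1)) ≤ entS a b := by
  unfold entS
  split_ifs with h₁ h₂
  · obtain ⟨ha, hb⟩ := h₁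
    refine ENNReal.ofReal_le_ofReal ?_
    have hexp : Real.exp (θ - Real.log (a / b)) * a = b * Real.exp θ := by
      rw [Real.exp_sub, Real.exp_log (div_pos ha hb)]
      field_simp
    nlinarith [Real.add_one_le_exp (θ - Real.log (a / b))]
  · obtain ⟨rfl, hb⟩ := h₂
    refine ENNReal.ofReal_le_ofReal ?_
    nlinarith [mul_nonneg hb (Real.exp_pos θ).le]
  · exact le_top

/-- The entropy function is at most any common upper bound of its linear minorants. -/
lemma entS_le_of_forall_ofReal_linear_le {a b : ℝ} (ha : 0 ≤ a) (hb : 0 ≤ b) {C : ℝ≥0∞}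
    (hC : ∀ θ : ℝ, ENNReal.ofReal (θ * a - b * (Real.exp θ - 1)) ≤ C) : entS a b ≤ C := by
  rcases ha.eq_or_lt with rfl | ha
  · have hlim : Tendsto (fun θ : ℝ => ENNReal.ofReal (θ * 0 - b * (Real.exp θ - 1))) atBot
        (nhds (ENNReal.ofReal b)) := by
      refine (ENNReal.continuous_ofReal.tendsto _).comp ?_
      have := ((Real.tendsto_exp_atBot.sub_const 1).const_mul b).const_sub 0
      simpa using this
    simpa [entS, hb] using le_of_tendsto' hlim hC
  · rcases hb.eq_or_lt with rfl | hb
    · have hlim : Tendsto (fun θ : ℝ => ENNReal.ofReal (θ * a - 0 * (Real.exp θ - 1))) atTop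
          (nhds ⊤) := by
        refine ENNReal.tendsto_ofReal_atTop.comp ?_
        simpa using tendsto_id.atTop_mul_const ha
      exact le_top.trans (le_of_tendsto' hlim hC)
    · have h := hC (Real.log (a / b))
      rw [Real.exp_log (div_pos ha hb)] at h
      simp only [entS, ha, hb, and_self, if_true]
      convert h using 2
      field_simp
      ring

/-- Without a sign condition, the integral is bounded by the lower integral of the positive part. -/
lemma ofReal_integral_le_lintegral_ofReal {α : Type*} [MeasurableSpace α] {μ : Measure α}
    {f : α → ℝ} (hf : Integrable f μ) :
    ENNReal.ofReal (∫ x, f x ∂μ) ≤ ∫⁻ x, ENNReal.ofReal (f x) ∂μ := by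
  refine ENNReal.ofReal_le_of_le_toReal ?_
  rw [integral_eq_lintegral_pos_part_sub_lintegral_neg_part hf]
  exact sub_le_self _ ENNReal.toReal_nonneg

/-- Jensen's inequality for the jointly convex entropy function, in integrated form. -/
lemma mul_entS_le_lintegral {T a b : ℝ} (hT : 0 < T) (ha : 0 ≤ a) (hb : 0 ≤ b) {f g : ℝ → ℝ}
    (hf : IntegrableOn f (Ioc 0 T)) (hg : IntegrableOn g (Ioc 0 T))
    (hfa : ∫ t in Ioc 0 T, f t = T * a) (hgb : ∫ t in Ioc 0 T, g t = T * b) :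
    entS a b ≤ ENNReal.ofReal (1 / T) * ∫⁻ t in Ioc 0 T, entS (f t) (g t) := by
  refine entS_le_of_forall_ofReal_linear_le ha hb fun θ => ?_
  have hint : ∫ t in Ioc 0 T, (θ * f t - g t * (Real.exp θ - 1))
      = T * (θ * a - b * (Real.exp θ - 1)) := by
    rw [integral_sub (hf.const_mul θ) (hg.mul_const _), integral_const_mul, integral_mul_const,
      hfa, hgb]
    ring
  calc ENNReal.ofReal (θ * a - b * (Real.exp θ - 1))
      = ENNReal.ofReal (1 / T) * ENNReal.ofReal (T * (θ * a - b * (Real.exp θ - 1))) := by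
        rw [← ENNReal.ofReal_mul (by positivity)]
        congr 1
        field_simp
    _ ≤ ENNReal.ofReal (1 / T) * ∫⁻ t in Ioc 0 T, entS (f t) (g t) := by
        rw [← hint]
        gcongr
        refine (ofReal_integral_le_lintegral_ofReal
          ((hf.const_mul θ).sub (hg.mul_const _))).trans ?_
        exact lintegral_mono fun t => ofReal_linear_le_entS _ _ _

lemma isCompact_Mmass {X : Type*} [Fintype X] (m : ℝ) : IsCompact (Mmass (X := X) m) := by
  refine (isCompact_Icc (a := (0 : X → ℝ)) (b := fun _ => m)).of_isClosed_subset ?_ ?_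
  · have h : Mmass (X := X) m = (⋂ x, {ρ | 0 ≤ ρ x}) ∩ {ρ | ∑ x, ρ x = m} := by
      ext ρ
      simp [Mmass]
    rw [h]
    exact (isClosed_iInter fun x => isClosed_le continuous_const (continuous_apply x)).inter
      (isClosed_eq (by fun_prop) continuous_const)
  · rintro ρ ⟨hρ, hsum⟩
    exact ⟨hρ, fun x => hsum ▸ Finset.single_le_sum (fun y _ => hρ y) (Finset.mem_univ x)⟩

lemma IsAdmissible.continuousOn {X : Type*} [Fintype X] [DecidableEq X] {E : Finset (X × X)}
    {m T : ℝ} {ρ : ℝ → X → ℝ} {q : ℝ → (X × X) → ℝ} (hT : 0 < T) (h : IsAdmissible E m T ρ q) :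
    ContinuousOn ρ (Icc 0 T) := by
  obtain ⟨-, -, hq, hρ⟩ := h
  refine continuousOn_pi.2 fun x => ?_
  have hdiv : IntervalIntegrable (fun s => divFlow E (q s) x) volume 0 T := by
    have h := IntervalIntegrable.sum E
      (f := fun e s => (if e.1 = x then q s e else 0) - (if e.2 = x then q s e else 0))
      (μ := volume) (a := 0) (b := T) fun e he => by
        refine IntervalIntegrable.sub ?_ ?_
        · split_ifs
          · exact hq e he
          · exact intervalIntegrable_const
        · split_ifs
          · exact hq e he
          · exact intervalIntegrable_const
    rwa [Finset.sum_fn] at h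
  have hcont := intervalIntegral.continuousOn_primitive_interval' hdiv left_mem_uIcc
  rw [uIcc_of_le hT.le] at hcont
  exact (continuousOn_const.sub hcont).congr fun t ht => hρ x t ht

/-- If the range of the rates is convex, then time averages of rates along a continuous curve are
rates. -/
lemma exists_rate_eq_average {X : Type*} [Fintype X] {E : Finset (X × X)} {m T : ℝ} (hT : 0 < T)
    {k : (X → ℝ) → (X × X) → ℝ} (hkc : ∀ e ∈ E, Continuous fun ρ : X → ℝ => k ρ e)
    (hconv : Convex ℝ (k '' Mmass m)) {ρ : ℝ → X → ℝ} (hρ : ContinuousOn ρ (Icc 0 T))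
    (hρm : ∀ t ∈ Icc 0 T, ρ t ∈ Mmass m) :
    ∃ σ ∈ Mmass m, ∀ e ∈ E, IntegrableOn (fun t => k (ρ t) e) (Ioc 0 T) ∧
      ∫ t in Ioc 0 T, k (ρ t) e = T * k σ e := by
  set κ : (X → ℝ) → E → ℝ := fun ρ e => k ρ e with hκ
  have hκc : Continuous κ := continuous_pi fun e => hkc e e.2
  have hκconv : Convex ℝ (κ '' Mmass m) := by
    have h := hconv.linear_image (LinearMap.funLeft ℝ ℝ (Subtype.val : E → X × X))
    rwa [image_image] at h
  have hκρ : IntegrableOn (fun t => κ (ρ t)) (Ioc 0 T) :=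
    ((hκc.comp_continuousOn hρ).integrableOn_compact isCompact_Icc).mono_set Ioc_subset_Icc_self
  have hmem : (⨍ t in Ioc 0 T, κ (ρ t)) ∈ κ '' Mmass m := by
    refine hκconv.set_average_mem ((isCompact_Mmass m).image hκc).isClosed (by simp [hT]) (by simp)
      ?_ hκρ
    filter_upwards [ae_restrict_mem measurableSet_Ioc] with t ht
    exact mem_image_of_mem κ (hρm t (Ioc_subset_Icc_self ht))
  obtain ⟨σ, hσ, hσκ⟩ := hmem
  refine ⟨σ, hσ, fun e he => ?_⟩
  have hint : ∀ e : E, IntegrableOn (fun t => κ (ρ t) e) (Ioc 0 T) := fun e => hκρ.eval e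
  refine ⟨hint ⟨e, he⟩, ?_⟩
  have h := congrFun hσκ ⟨e, he⟩
  rw [setAverage_eq, Pi.smul_apply, eval_integral hint] at h
  simp only [hκ, Real.volume_real_Ioc_of_le hT.le, sub_zero, smul_eq_mul] at h
  rw [h]
  field_simp

lemma PsiT_le_PsiPlus {X : Type*} [Fintype X] [DecidableEq X] (E : Finset (X × X))
    (k : (X → ℝ) → (X × X) → ℝ) (m : ℝ) {T : ℝ} (hT : 0 < T) {qbar : (X × X) → ℝ}
    (hq : qbar ∈ MFlow E) (hdiv : ∀ x, divFlow E qbar x = 0) :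
    PsiT E k m T qbar ≤ PsiPlus E k m qbar := by
  rw [PsiPlus, if_pos hdiv]
  refine le_iInf₂ fun ρ hρ => ?_
  have hadm : InAdm E m T qbar (fun _ => ρ) (fun _ => qbar) :=
    ⟨⟨fun _ _ => hρ, fun _ _ => hq, fun _ _ => intervalIntegrable_const, fun x t _ => by
      simp [hdiv]⟩, fun e _ => by simp⟩
  have hcost : costI E k T (fun _ => ρ) (fun _ => qbar)
      = ENNReal.ofReal T * ∑ e ∈ E, entS (qbar e) (k ρ e) := by
    simp [costI, Finset.mul_sum, mul_comm]
  calc PsiT E k m T qbar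
      ≤ ENNReal.ofReal (1 / T) * costI E k T (fun _ => ρ) (fun _ => qbar) := by
        unfold PsiT
        gcongr
        exact iInf₂_le_of_le ((fun _ => ρ), fun _ => qbar) hadm le_rfl
    _ = ∑ e ∈ E, entS (qbar e) (k ρ e) := by
        rw [hcost, ← mul_assoc, ← ENNReal.ofReal_mul (by positivity), one_div_mul_cancel hT.ne',
          ENNReal.ofReal_one, one_mul]

lemma PsiPlus_le_PsiT {X : Type*} [Fintype X] [DecidableEq X] {E : Finset (X × X)}
    {k : (X → ℝ) → (X × X) → ℝ} {m T : ℝ} (hT : 0 < T)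
    (hknn : ∀ ρ ∈ Mmass (X := X) m, ∀ e ∈ E, 0 ≤ k ρ e)
    (hkc : ∀ e ∈ E, Continuous fun ρ : X → ℝ => k ρ e)
    (hconv : Convex ℝ (k '' Mmass m)) {qbar : (X × X) → ℝ}
    (hq : qbar ∈ MFlow E) (hdiv : ∀ x, divFlow E qbar x = 0) :
    PsiPlus E k m qbar ≤ PsiT E k m T qbar := by
  rw [PsiPlus, if_pos hdiv, PsiT, ENNReal.mul_iInf_of_ne (by simpa using hT) ENNReal.ofReal_ne_top]
  refine le_iInf fun p => ?_
  rw [ENNReal.mul_iInf_of_ne (by simpa using hT) ENNReal.ofReal_ne_top]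
  refine le_iInf fun hp => ?_
  obtain ⟨σ, hσ, hσk⟩ := exists_rate_eq_average hT hkc hconv (hp.1.continuousOn hT) hp.1.1
  refine iInf₂_le_of_le σ hσ ?_
  rw [costI, Finset.mul_sum]
  refine Finset.sum_le_sum fun e he => ?_
  refine mul_entS_le_lintegral hT (hq e he) (hknn σ hσ e he)
    ((intervalIntegrable_iff_integrableOn_Ioc_of_le hT.le).1 (hp.1.2.2.1 e he)) (hσk e he).1 ?_
    (hσk e he).2
  rw [← intervalIntegral.integral_of_le hT.le]
  exact hp.2 e he

/-- Corollary "convex range": if `Ran_m(k)` is convex then `Ψ_m = Ψ⁺_m` on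
divergence-free flows; in particular there are no dynamical phase transitions. -/
theorem no_DPT_of_convex_range {X : Type*} [Fintype X] [DecidableEq X] [Nonempty X]
    (E : Finset (X × X)) (hE : ∀ x : X, (x, x) ∉ E)
    (m : ℝ) (hm : 0 < m)
    (k : (X → ℝ) → (X × X) → ℝ)
    (hknn : ∀ ρ ∈ Mmass (X := X) m, ∀ e ∈ E, 0 ≤ k ρ e)
    (hkc : ∀ e ∈ E, Continuous fun ρ : X → ℝ => k ρ e)
    (hconv : Convex ℝ (k '' Mmass m)) :
    ∀ qbar ∈ MFlow E, (∀ x, divFlow E qbar x = 0) →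
      PsiM E k m qbar = PsiPlus E k m qbar ∧
      ¬ PsiM E k m qbar < PsiPlus E k m qbar := by
  intro qbar hq hdiv
  have heq : PsiM E k m qbar = PsiPlus E k m qbar := by
    refine Tendsto.limsup_eq (tendsto_const_nhds.congr' ?_)
    filter_upwards [eventually_gt_atTop 0] with T hT
    exact (PsiPlus_le_PsiT hT hknn hkc hconv hq hdiv).antisymm
      (PsiT_le_PsiPlus E k m hT hq hdiv)
  exact ⟨heq, heq.not_lt⟩
end

section
/- Existence of a time-dependent strategy beating the constant one on large rings: let κ : [0,∞) → [0,∞) be smooth and strictly increasing with κ(0) = 0, and suppose there exist Φ̄ > δ > 0, τ > 0 and μ ≥ 0 such that φ ↦ s(φ | κ(μ + τφ)) is strictly concave on [Φ̄−δ, Φ̄+δ]. Then there exists L₀ such that for every integer L ≥ L₀ the following holds on the discrete ring with L sites, rates k_{x,x+1}(ρ) = Lκ(ρ_x) and mass m := L(μ + τΦ̄): for the constant flow q̄ ∈ M(E) with q̄_{x,x+1} = LΦ̄ for all x, there exist T > 0 and (ρ,q) ∈ A_{T,m}(q̄) with (1/T) I_{[0,T]}(ρ,q) < L² s(Φ̄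 | κ(μ + τΦ̄)). -/
open MeasureTheory Filter Set
open scoped Classical ENNReal NNReal

/-- The edge set of the directed discrete ring on `ℤ/Lℤ`. -/
def ringEdges (L : ℕ) [NeZero L] : Finset (ZMod L × ZMod L) :=
  Finset.univ.image (fun x : ZMod L => (x, x + 1))

/-- The zero-range rates `k_{x,x+1}(ρ) = L κ(ρ_x)` on the ring (as a function of the edge). -/
noncomputable def kRing (L : ℕ) (κ : ℝ → ℝ) : (ZMod L → ℝ) → (ZMod L × ZMod L) → ℝ :=
  fun ρ e => (L : ℝ) * κ (ρ e.1)

lemma divFlow_ringEdges (L : ℕ) [NeZero L] (w : ZMod L × ZMod L → ℝ) (x : ZMod L) :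
    divFlow (ringEdges L) w x = w (x, x + 1) - w (x - 1, x) := by
  unfold divFlow ringEdges
  rw [Finset.sum_image (fun a _ b _ h => congrArg Prod.fst h), Finset.sum_sub_distrib]
  congr 1
  · simp
  · simp only [← eq_sub_iff_add_eq]
    simp

lemma periodic_val_sub_one {h : ℝ → ℝ} (hh : Function.Periodic h 1) (L : ℕ) [NeZero L]
    (x : ZMod L) (s : ℝ) :
    h (((x - 1).val : ℝ) / L - s) = h (((x.val : ℝ) - 1) / L - s) := by
  have hd : (((x - 1).val : ℤ) : ZMod L) = ((x.val : ℤ) - 1 : ℤ) := by simp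
  obtain ⟨n, hn⟩ := (ZMod.intCast_eq_intCast_iff_dvd_sub _ _ L).1 hd
  have hn' : (x.val : ℝ) - 1 - ((x - 1).val : ℝ) = L * n := by exact_mod_cast hn
  have hL : (L : ℝ) ≠ 0 := Nat.cast_ne_zero.2 (NeZero.ne L)
  have : ((x.val : ℝ) - 1) / L - s = ((x - 1).val : ℝ) / L - s + n * 1 := by
    field_simp
    linarith
  rw [this, hh.int_mul n]

lemma sum_zmod_val (L : ℕ) [NeZero L] (h : ℕ → ℝ) :
    ∑ x : ZMod L, h x.val = ∑ i ∈ Finset.range L, h i := by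
  obtain ⟨n, rfl⟩ := Nat.exists_eq_succ_of_ne_zero (NeZero.ne L)
  exact Fin.sum_univ_eq_sum_range h (n + 1)

lemma sR_nonneg {a b : ℝ} (ha : 0 < a) (hb : 0 < b) : 0 ≤ sR a b := by
  unfold sR
  have h := Real.log_le_sub_one_of_pos (div_pos hb ha)
  have h2 : Real.log (a / b) = -Real.log (b / a) := by rw [← Real.log_inv, inv_div]
  have h3 := mul_le_mul_of_nonneg_left h ha.le
  have h4 : a * (b / a - 1) = b - a := by field_simp
  rw [h2]
  linarith

lemma entS_mul_left {c a b : ℝ} (hc : 0 < c) (ha : 0 < a) (hb : 0 < b) :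
    entS (c * a) (c * b) = ENNReal.ofReal (c * sR a b) := by
  rw [entS, if_pos ⟨mul_pos hc ha, mul_pos hc hb⟩, mul_div_mul_left _ _ hc.ne', sR]
  congr 1
  ring

/-- A sinusoidal profile of mean `a` and amplitude `d`. -/
noncomputable def wave (a d u : ℝ) : ℝ := a + d * Real.sin (2 * Real.pi * u)

/-- A primitive of `wave a d`. -/
noncomputable def wavePrim (a d u : ℝ) : ℝ :=
  a * u - d * Real.cos (2 * Real.pi * u) / (2 * Real.pi)

lemma wave_continuous (a d : ℝ) : Continuous (wave a d) := by
  unfold wave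
  fun_prop

lemma wave_periodic (a d : ℝ) : Function.Periodic (wave a d) 1 := fun u => by
  simp only [wave, mul_add, mul_one, Real.sin_add_two_pi]

lemma wave_add_half (a d u : ℝ) : wave a d (u + 1 / 2) = 2 * a - wave a d u := by
  have : 2 * Real.pi * (u + 1 / 2) = 2 * Real.pi * u + Real.pi := by ring
  simp only [wave, this, Real.sin_add_pi]
  ring

lemma wave_mem (a : ℝ) {d : ℝ} (hd : 0 < d) (u : ℝ) : wave a d u ∈ Icc (a - d) (a + d) := by
  have h1 := Real.sin_le_one (2 * Real.pi * u)
  have h2 := Real.neg_one_le_sin (2 * Real.pi * u)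
  constructor <;> unfold wave <;> nlinarith

lemma dist_wave_le (a : ℝ) {d : ℝ} (hd : 0 < d) (u v : ℝ) :
    |wave a d u - wave a d v| ≤ d * (2 * Real.pi) * |u - v| := by
  have h := Real.abs_sin_sub_sin_le (2 * Real.pi * u) (2 * Real.pi * v)
  have h1 : wave a d u - wave a d v
      = d * (Real.sin (2 * Real.pi * u) - Real.sin (2 * Real.pi * v)) := by
    unfold wave
    ring
  rw [← mul_sub (2 * Real.pi) u v, abs_mul, abs_of_pos Real.two_pi_pos] at h
  rw [h1, abs_mul, abs_of_pos hd, mul_assoc d]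
  exact mul_le_mul_of_nonneg_left h hd.le

lemma wavePrim_hasDerivAt (a d u : ℝ) : HasDerivAt (wavePrim a d) (wave a d u) u := by
  have h1 : HasDerivAt (fun u : ℝ => 2 * Real.pi * u) (2 * Real.pi) u := by
    simpa using (hasDerivAt_id u).const_mul (2 * Real.pi)
  have h2 := ((hasDerivAt_id u).const_mul a).sub ((h1.cos.const_mul d).div_const (2 * Real.pi))
  refine h2.congr_deriv ?_
  have := Real.pi_ne_zero
  unfold wave
  field_simp
  ring

lemma wavePrim_add_one (a d u : ℝ) : wavePrim a d (u + 1) = wavePrim a d u + a := by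
  simp only [wavePrim, mul_add, mul_one, Real.cos_add_two_pi]
  ring

lemma integral_wave (a d u : ℝ) : ∫ s in (u - 1)..u, wave a d s = a := by
  rw [intervalIntegral.integral_eq_sub_of_hasDerivAt (fun s _ => wavePrim_hasDerivAt a d s)
    ((wave_continuous a d).intervalIntegrable _ _)]
  have := wavePrim_add_one a d (u - 1)
  rw [sub_add_cancel] at this
  linarith

lemma exists_wave_eq_average (a d u : ℝ) {L : ℕ} (hL : 0 < L) :
    ∃ v, |u - v| ≤ 1 / L ∧
      L * (wavePrim a d u - wavePrim a d (u - 1 / L)) = wave a d v := by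
  have hL' : (0 : ℝ) < L := Nat.cast_pos.2 hL
  have hlt : u - 1 / L < u := sub_lt_self _ (by positivity)
  obtain ⟨v, hv, h⟩ := exists_hasDerivAt_eq_slope (wavePrim a d) (wave a d) hlt
    (fun s _ => (wavePrim_hasDerivAt a d s).continuousAt.continuousWithinAt)
    (fun s _ => wavePrim_hasDerivAt a d s)
  refine ⟨v, ?_, ?_⟩
  · rw [abs_of_pos (sub_pos.2 hv.2)]
    linarith [hv.1]
  · rw [h, sub_sub_cancel]
    field_simp

/-- Strict Jensen inequality for the wave profile. -/
lemma integral_comp_wave_lt {g : ℝ → ℝ} {a d : ℝ} (hd : 0 < d)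
    (hg : StrictConcaveOn ℝ (Icc (a - d) (a + d)) g) (hc : Continuous fun u => g (wave a d u)) :
    ∫ u in (0 : ℝ)..1, g (wave a d u) < g a := by
  have hper : Function.Periodic (fun u => g (wave a d u)) 1 := fun u => by
    simp only [wave_periodic a d u]
  have hshift : ∫ u in (0 : ℝ)..1, g (wave a d (u + 1 / 2)) = ∫ u in (0 : ℝ)..1, g (wave a d u) := by
    rw [intervalIntegral.integral_comp_add_right (fun u => g (wave a d u))]
    have := hper.intervalIntegral_add_eq (1 / 2) 0
    rw [zero_add, add_comm] at this
    rw [zero_add, this]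
  have hc' : Continuous fun u => g (wave a d (u + 1 / 2)) :=
    hc.comp (continuous_id.add continuous_const)
  have hmid (u : ℝ) : (1 / 2 : ℝ) • wave a d u + (1 / 2 : ℝ) • wave a d (u + 1 / 2) = a := by
    rw [wave_add_half]
    simp only [smul_eq_mul]
    ring
  have hle (u : ℝ) : g (wave a d u) + g (wave a d (u + 1 / 2)) ≤ 2 * g a := by
    have := hg.concaveOn.2 (wave_mem a hd u) (wave_mem a hd (u + 1 / 2))
      (by norm_num : (0 : ℝ) ≤ 1 / 2) (by norm_num : (0 : ℝ) ≤ 1 / 2) (by norm_num)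
    rw [hmid] at this
    simp only [smul_eq_mul] at this
    linarith
  have hlt : g (wave a d (1 / 4)) + g (wave a d (1 / 4 + 1 / 2)) < 2 * g a := by
    have hq : wave a d (1 / 4) = a + d := by
      have : 2 * Real.pi * (1 / 4) = Real.pi / 2 := by ring
      rw [wave, this, Real.sin_pi_div_two, mul_one]
    have hne : wave a d (1 / 4) ≠ wave a d (1 / 4 + 1 / 2) := by
      rw [wave_add_half, hq]
      intro h
      linarith
    have := hg.2 (wave_mem a hd (1 / 4)) (wave_mem a hd (1 / 4 + 1 / 2)) hne
      (by norm_num : (0 : ℝ) < 1 / 2) (by norm_num : (0 : ℝ) < 1 / 2) (by norm_num)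
    rw [hmid] at this
    simp only [smul_eq_mul] at this
    linarith
  have hint := intervalIntegral.integral_lt_integral_of_continuousOn_of_le_of_exists_lt
    (zero_lt_one' ℝ)
    (f := fun u => g (wave a d u) + g (wave a d (u + 1 / 2)))
    (hc.add hc').continuousOn (continuousOn_const (c := 2 * g a))
    (fun u _ => hle u) ⟨1 / 4, by norm_num, hlt⟩
  rw [intervalIntegral.integral_add (hc.intervalIntegrable _ _) (hc'.intervalIntegrable _ _),
    hshift] at hint
  simp only [intervalIntegral.integral_const, sub_zero, smul_eq_mul, one_mul] at hint
  linarith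

/-- Traveling wave densities on the ring. -/
noncomputable def waveDensity (a d τ μ : ℝ) (L : ℕ) (t : ℝ) (x : ZMod L) : ℝ :=
  μ + τ * (L * (wavePrim a d ((x.val : ℝ) / L - t / τ)
    - wavePrim a d ((x.val : ℝ) / L - t / τ - 1 / L)))

/-- Traveling wave flows on the ring. -/
noncomputable def waveFlow (a d τ : ℝ) (L : ℕ) (t : ℝ) (e : ZMod L × ZMod L) : ℝ :=
  L * wave a d ((e.1.val : ℝ) / L - t / τ)

lemma waveFlow_continuous (a d τ : ℝ) (L : ℕ) (e : ZMod L × ZMod L) :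
    Continuous fun t => waveFlow a d τ L t e := by
  unfold waveFlow
  have := wave_continuous a d
  fun_prop

lemma sum_waveDensity (a d τ μ : ℝ) (L : ℕ) [NeZero L] (t : ℝ) :
    ∑ x, waveDensity a d τ μ L t x = L * (μ + τ * a) := by
  have hL : (L : ℝ) ≠ 0 := Nat.cast_ne_zero.2 (NeZero.ne L)
  have htel : ∑ i ∈ Finset.range L, (wavePrim a d ((i : ℝ) / L - t / τ)
      - wavePrim a d ((i : ℝ) / L - t / τ - 1 / L)) = a := by
    have h1 := Finset.sum_range_sub
      (fun i : ℕ => wavePrim a d ((i : ℝ) / L - t / τ - 1 / L)) L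
    have h2 := wavePrim_add_one a d (0 - t / τ - 1 / L)
    have h3 : (0 : ℝ) - t / τ - 1 / L + 1 = 1 - t / τ - 1 / L := by ring
    rw [h3] at h2
    simp only [div_self hL, Nat.cast_zero, zero_div, h2, add_sub_cancel_left] at h1
    rw [← h1]
    refine Finset.sum_congr rfl fun i _ => ?_
    congr 2
    push_cast
    ring
  have h := sum_zmod_val L (fun i => μ + τ * (L * (wavePrim a d ((i : ℝ) / L - t / τ)
    - wavePrim a d ((i : ℝ) / L - t / τ - 1 / L))))
  unfold waveDensity
  rw [h, Finset.sum_add_distrib, ← Finset.mul_sum, ← Finset.mul_sum, htel]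
  simp
  ring

lemma waveDensity_hasDerivAt (a d μ : ℝ) {τ : ℝ} (hτ : 0 < τ) (L : ℕ) [NeZero L] (t : ℝ)
    (x : ZMod L) :
    HasDerivAt (fun t => waveDensity a d τ μ L t x)
      (-divFlow (ringEdges L) (waveFlow a d τ L t) x) t := by
  have hlin (c : ℝ) : HasDerivAt (fun t : ℝ => c - t / τ) (-(1 / τ)) t := by
    simpa using ((hasDerivAt_id t).div_const τ).const_sub c
  have h1 := (wavePrim_hasDerivAt a d ((x.val : ℝ) / L - t / τ)).comp t
    (hlin ((x.val : ℝ) / L))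
  have h2 := (wavePrim_hasDerivAt a d ((x.val : ℝ) / L - t / τ - 1 / L)).comp t
    ((hlin ((x.val : ℝ) / L)).sub_const (1 / (L : ℝ)))
  have h3 := (((h1.sub h2).const_mul (L : ℝ)).const_mul τ).const_add μ
  refine h3.congr_deriv ?_
  rw [divFlow_ringEdges]
  simp only [waveFlow]
  rw [periodic_val_sub_one (wave_periodic a d)]
  have : ((x.val : ℝ) - 1) / L - t / τ = (x.val : ℝ) / L - t / τ - 1 / L := by ring
  rw [this]
  field_simp
  ring

lemma exists_waveDensity_eq (a d τ μ : ℝ) (L : ℕ) [NeZero L] (t : ℝ) (x : ZMod L) :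
    ∃ v, |(x.val : ℝ) / L - t / τ - v| ≤ 1 / L ∧
      waveDensity a d τ μ L t x = μ + τ * wave a d v := by
  obtain ⟨v, hv, h⟩ := exists_wave_eq_average a d ((x.val : ℝ) / L - t / τ) (NeZero.pos L)
  exact ⟨v, hv, by rw [waveDensity, h]⟩

lemma inAdm_wave {a d τ μ : ℝ} (hd : 0 < d) (had : d < a) (hτ : 0 < τ) (hμ : 0 ≤ μ)
    (L : ℕ) [NeZero L] :
    InAdm (ringEdges L) ((L : ℝ) * (μ + τ * a)) τ (fun _ => (L : ℝ) * a)
      (waveDensity a d τ μ L) (waveFlow a d τ L) := by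
  have hpos (u : ℝ) : 0 < wave a d u := by linarith [(wave_mem a hd u).1]
  refine ⟨⟨fun t _ => ⟨fun x => ?_, sum_waveDensity a d τ μ L t⟩, fun t _ e _ => ?_,
    fun e _ => (waveFlow_continuous a d τ L e).intervalIntegrable _ _, fun x t _ => ?_⟩,
    fun e _ => ?_⟩
  · obtain ⟨v, -, h⟩ := exists_waveDensity_eq a d τ μ L t x
    rw [h]
    have := hpos v
    positivity
  · have := hpos ((e.1.val : ℝ) / L - t / τ)
    unfold waveFlow
    positivity
  · have hcont : Continuous fun s => divFlow (ringEdges L) (waveFlow a d τ L s) x := by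
      simp only [divFlow_ringEdges]
      exact (waveFlow_continuous ..).sub (waveFlow_continuous ..)
    have := intervalIntegral.integral_eq_sub_of_hasDerivAt (a := 0) (b := t)
      (fun s _ => waveDensity_hasDerivAt a d μ hτ L s x) (hcont.neg.intervalIntegrable _ _)
    rw [intervalIntegral.integral_neg] at this
    linarith
  · simp only [waveFlow]
    rw [intervalIntegral.integral_const_mul, intervalIntegral.integral_comp_sub_div _ hτ.ne',
      div_self hτ.ne', zero_div, sub_zero, integral_wave, smul_eq_mul]
    ring

/-- under the strict-concavity assumption on `φ ↦ s(φ | κ(μ + τφ))` near `Φ̄`,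
for all sufficiently large `L` one can beat the constant strategy on the ring with `L` sites,
rates `k_{x,x+1}(ρ) = Lκ(ρ_x)` and mass `m = L(μ + τΦ̄)`: for the constant flow
`q̄ ≡ LΦ̄` there are `T > 0` and `(ρ,q) ∈ A_{T,m}(q̄)` with
`(1/T) I_{[0,T]}(ρ,q) < L² s(Φ̄ | κ(μ + τΦ̄))`. -/
theorem time_dependent_beats_constant (κ : ℝ → ℝ)
    (hκsmooth : ContDiffOn ℝ (⊤ : ℕ∞) κ (Set.Ici 0))
    (hκmono : StrictMonoOn κ (Set.Ici 0)) (hκ0 : κ 0 = 0)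
    (Φbar δ τ μ : ℝ) (hδ : 0 < δ) (hΦδ : δ < Φbar) (hτ : 0 < τ) (hμ : 0 ≤ μ)
    (hconc : StrictConcaveOn ℝ (Set.Icc (Φbar - δ) (Φbar + δ))
      (fun φ => sR φ (κ (μ + τ * φ)))) :
    ∃ L₀ : ℕ, ∀ L : ℕ, [NeZero L] → L₀ ≤ L →
      ∃ T > (0:ℝ), ∃ ρ q,
        InAdm (ringEdges L) ((L : ℝ) * (μ + τ * Φbar)) T
          (fun _ => (L : ℝ) * Φbar) ρ q ∧
        ENNReal.ofReal (1 / T) * costI (ringEdges L) (kRing L κ) T ρ q <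
          ENNReal.ofReal ((L : ℝ) ^ 2 * sR Φbar (κ (μ + τ * Φbar))) := by
  set K := Icc (Φbar - δ) (Φbar + δ)
  set g : ℝ → ℝ := fun φ => sR φ (κ (μ + τ * φ))
  have hKpos {r : ℝ} (hr : r ∈ K) : 0 < r := by linarith [hr.1]
  have hκpos {r : ℝ} (hr : r ∈ K) : 0 < κ (μ + τ * r) := by
    have : 0 < μ + τ * r := by have := hKpos hr; positivity
    simpa [hκ0] using hκmono (mem_Ici.2 le_rfl) (mem_Ici.2 this.le) this
  have hH : ContinuousOn (fun p : ℝ × ℝ => sR p.1 (κ (μ + τ * p.2))) (K ×ˢ K) := by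
    have hk : ContinuousOn (fun p : ℝ × ℝ => κ (μ + τ * p.2)) (K ×ˢ K) :=
      hκsmooth.continuousOn.comp (by fun_prop) fun p hp => by
        have := hKpos hp.2
        exact mem_Ici.2 (by positivity)
    have hfst : ContinuousOn (fun p : ℝ × ℝ => p.1) (K ×ˢ K) := continuousOn_fst
    unfold sR
    exact ((hfst.mul ((hfst.div hk fun p hp => (hκpos hp.2).ne').log
      fun p hp => (div_pos (hKpos hp.1) (hκpos hp.2)).ne')).sub hfst).add hk
  have hunif := (isCompact_Icc.prod isCompact_Icc).uniformContinuousOn_of_continuous hH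
  have hgf : Continuous fun u => g (wave Φbar δ u) :=
    hH.comp_continuous ((wave_continuous Φbar δ).prodMk (wave_continuous Φbar δ))
      fun u => ⟨wave_mem Φbar hδ u, wave_mem Φbar hδ u⟩
  have hgper : Function.Periodic (fun u => g (wave Φbar δ u)) 1 := fun u => by
    simp only [wave_periodic Φbar δ u]
  have hJ := integral_comp_wave_lt hδ hconc hgf
  set J := ∫ u in (0 : ℝ)..1, g (wave Φbar δ u)
  obtain ⟨ε, hε, hJε⟩ : ∃ ε > 0, J + ε < g Φbar :=
    ⟨(g Φbar - J) / 2, by linarith, by linarith⟩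
  obtain ⟨η, hη, hclose⟩ := Metric.uniformContinuousOn_iff.1 hunif ε hε
  obtain ⟨L₀, hL₀⟩ := exists_nat_gt (δ * (2 * Real.pi) / η)
  refine ⟨L₀, fun L _ hL => ⟨τ, hτ, waveDensity Φbar δ τ μ L, waveFlow Φbar δ τ L,
    inAdm_wave hδ hΦδ hτ hμ L, ?_⟩⟩
  have hLpos : (0 : ℝ) < L := Nat.cast_pos.2 (NeZero.pos L)
  have hLη : δ * (2 * Real.pi) * (1 / L) < η := by
    have : δ * (2 * Real.pi) / η < L := hL₀.trans_le (Nat.cast_le.2 hL)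
    rw [div_lt_iff₀ hη] at this
    rw [mul_one_div, div_lt_iff₀ hLpos]
    linarith
  have hgnn (u : ℝ) : 0 ≤ g (wave Φbar δ u) :=
    sR_nonneg (hKpos (wave_mem Φbar hδ u)) (hκpos (wave_mem Φbar hδ u))
  have hpt (e : ZMod L × ZMod L) (t : ℝ) :
      entS (waveFlow Φbar δ τ L t e) (kRing L κ (waveDensity Φbar δ τ μ L t) e) ≤
        ENNReal.ofReal (L * (g (wave Φbar δ ((e.1.val : ℝ) / L - t / τ)) + ε)) := by
    obtain ⟨v, hv, h⟩ := exists_waveDensity_eq Φbar δ τ μ L t e.1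
    set u := (e.1.val : ℝ) / L - t / τ with hu
    have hum := wave_mem Φbar hδ u
    have hvm := wave_mem Φbar hδ v
    rw [kRing, waveFlow, h, ← hu, entS_mul_left hLpos (hKpos hum) (hκpos hvm)]
    refine ENNReal.ofReal_le_ofReal (mul_le_mul_of_nonneg_left ?_ hLpos.le)
    have hdist : dist (wave Φbar δ v) (wave Φbar δ u) < η := by
      rw [dist_comm, Real.dist_eq]
      exact ((dist_wave_le Φbar hδ u v).trans
        (mul_le_mul_of_nonneg_left hv (by positivity))).trans_lt hLη
    have := hclose (wave Φbar δ u, wave Φbar δ v) ⟨hum, hvm⟩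
      (wave Φbar δ u, wave Φbar δ u) ⟨hum, hum⟩ (by simpa [Prod.dist_eq, hη] using hdist)
    rw [Real.dist_eq] at this
    linarith [(abs_lt.1 this).2]
  have hedge (e : ZMod L × ZMod L) :
      ∫⁻ t in Ioc (0 : ℝ) τ,
          entS (waveFlow Φbar δ τ L t e) (kRing L κ (waveDensity Φbar δ τ μ L t) e) ≤
        ENNReal.ofReal (L * (τ * (J + ε))) := by
    have hcont : Continuous fun t : ℝ =>
        L * (g (wave Φbar δ ((e.1.val : ℝ) / L - t / τ)) + ε) :=
      continuous_const.mul ((hgf.comp (by fun_prop : Continuous fun t : ℝ =>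
        (e.1.val : ℝ) / L - t / τ)).add continuous_const)
    have hcont' : Continuous fun t : ℝ => g (wave Φbar δ ((e.1.val : ℝ) / L - t / τ)) :=
      hgf.comp (by fun_prop : Continuous fun t : ℝ => (e.1.val : ℝ) / L - t / τ)
    refine (lintegral_mono (hpt e)).trans_eq ?_
    rw [← ofReal_integral_eq_lintegral_ofReal (hcont.integrableOn_Ioc)
      (ae_of_all _ fun t => mul_nonneg hLpos.le (add_nonneg (hgnn _) hε.le)),
      ← intervalIntegral.integral_of_le hτ.le, intervalIntegral.integral_const_mul,
      intervalIntegral.integral_add (hcont'.intervalIntegrable _ _) (by simp),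
      intervalIntegral.integral_comp_sub_div (fun u => g (wave Φbar δ u)) hτ.ne',
      div_self hτ.ne', zero_div, sub_zero]
    have hp := hgper.intervalIntegral_add_eq ((e.1.val : ℝ) / L - 1) 0
    rw [sub_add_cancel, zero_add] at hp
    rw [hp]
    simp only [intervalIntegral.integral_const, smul_eq_mul, sub_zero]
    congr 1
    ring
  have hcard : (ringEdges L).card ≤ L := by
    have := Finset.card_image_le (s := Finset.univ) (f := fun x : ZMod L => (x, x + 1))
    rwa [Finset.card_univ, ZMod.card] at this
  have hcost : costI (ringEdges L) (kRing L κ) τ (waveDensity Φbar δ τ μ L)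
      (waveFlow Φbar δ τ L) ≤ ENNReal.ofReal (L * (L * (τ * (J + ε)))) := by
    refine (Finset.sum_le_card_nsmul _ _ _ fun e _ => hedge e).trans ?_
    rw [ENNReal.ofReal_mul hLpos.le (q := L * (τ * (J + ε))), ENNReal.ofReal_natCast, nsmul_eq_mul]
    gcongr
  have hgpos : 0 < g Φbar := by
    have : 0 ≤ J := intervalIntegral.integral_nonneg zero_le_one fun u _ => hgnn u
    linarith
  calc ENNReal.ofReal (1 / τ) * costI (ringEdges L) (kRing L κ) τ
        (waveDensity Φbar δ τ μ L) (waveFlow Φbar δ τ L)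
      ≤ ENNReal.ofReal (1 / τ) * ENNReal.ofReal (L * (L * (τ * (J + ε)))) := by gcongr
    _ = ENNReal.ofReal ((L : ℝ) ^ 2 * (J + ε)) := by
      rw [← ENNReal.ofReal_mul (by positivity)]
      congr 1
      field_simp
    _ < ENNReal.ofReal ((L : ℝ) ^ 2 * sR Φbar (κ (μ + τ * Φbar))) :=
      (ENNReal.ofReal_lt_ofReal_iff (mul_pos (by positivity) hgpos)).2
        (mul_lt_mul_of_pos_left hJε (by positivity))
end
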